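/- arXiv:0910.1308 — 11 statements merged into one kernel-verified Lean document; each statement's English description precedes it below -/
import Mathlib

section
/- Let W be a finite-dimensional real vector space and let C be a set of linear automorphisms of W whose common fixed subspace is trivial: {x ∈ W : c(x) = x for all c ∈ C} = {0}. Let M be a compact subgroup of the topological group Aff(W) of affine automorphisms of W such that every element of C (regarded as an affine map) belongs to M. Then every element of M is linear, i.e., M ⊆ GL(W). -/
/-- Let `W` be a finite-dimensional real vector space and `C` a set of linear
automorphisms of `W` with trivial common fixed subspace.  If `M` is a compact subgroup of the
affine group `Aff(W)` (topologized via `Aff(W) ≅ GL(W) × W`, `e ↦ (linear part, e 0)`) whose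
elements include all members of `C` (regarded as affine maps), then every element of `M` is
linear. -/
theorem stmt3 {W : Type*} [NormedAddCommGroup W] [NormedSpace ℝ W] [FiniteDimensional ℝ W]
    (C : Set (W ≃ₗ[ℝ] W)) (hC : {x : W | ∀ c ∈ C, c x = x} = {0})
    (M : Subgroup (W ≃ᵃ[ℝ] W))
    (hCM : ∀ c ∈ C, LinearEquiv.toAffineEquiv c ∈ M)
    (hM : IsCompact ((fun e : W ≃ᵃ[ℝ] W =>
        ((LinearMap.toContinuousLinearMap (e.linear : W →ₗ[ℝ] W), e 0) : (W →L[ℝ] W) × W)) ''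
        (M : Set (W ≃ᵃ[ℝ] W)))) :
    ∀ e ∈ M, ∃ g : W ≃ₗ[ℝ] W, e = LinearEquiv.toAffineEquiv g := by
  have happ : ∀ (e : W ≃ᵃ[ℝ] W) (x : W), e x = e.linear x + e 0 := by
    intro e x
    have := e.map_vadd 0 x
    simpa using this
  let φ := toEuclidean (E := W)
  set K := ((fun e : W ≃ᵃ[ℝ] W =>
        ((LinearMap.toContinuousLinearMap (e.linear : W →ₗ[ℝ] W), e 0) : (W →L[ℝ] W) × W)) ''
        (M : Set (W ≃ᵃ[ℝ] W))) with hK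
  let f : W → ((W →L[ℝ] W) × W) → ℝ := fun x p => ‖φ (p.1 x + p.2)‖
  have hf : Continuous ↿f := by
    have : Continuous fun q : W × ((W →L[ℝ] W) × W) => ‖φ (q.2.1 q.1 + q.2.2)‖ := by fun_prop
    exact this
  have hfx : ∀ x, Continuous (f x) := fun x => by
    have : Continuous fun p : (W →L[ℝ] W) × W => ‖φ (p.1 x + p.2)‖ := by fun_prop
    exact this
  have hne : K.Nonempty := ⟨_, 1, M.one_mem, rfl⟩
  obtain ⟨F, hFc, hFle, hFatt⟩ : ∃ F : W → ℝ, Continuous F ∧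
      (∀ x, ∀ e ∈ M, ‖φ (e x)‖ ≤ F x) ∧ (∀ x, ∃ e ∈ M, F x = ‖φ (e x)‖) := by
    refine ⟨fun x => sSup (f x '' K), hM.continuous_sSup hf, ?_, ?_⟩
    · intro x e he
      refine le_csSup (hM.image (hfx x)).bddAbove ⟨_, ⟨e, he, rfl⟩, ?_⟩
      rw [happ e x]
      rfl
    · intro x
      obtain ⟨p, ⟨e, he, rfl⟩, h⟩ := (hM.image (hfx x)).sSup_mem (hne.image _)
      refine ⟨e, he, ?_⟩
      rw [happ e x]
      exact h.symm
  have hlim : Filter.Tendsto F (Filter.cocompact W) Filter.atTop := by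
    refine Filter.tendsto_atTop_mono (fun x => hFle x 1 M.one_mem) ?_
    exact (tendsto_norm_cocompact_atTop (E := EuclideanSpace ℝ (Fin (Module.finrank ℝ W)))).comp
      φ.toHomeomorph.isClosedEmbedding.tendsto_cocompact
  obtain ⟨x, hx⟩ := hFc.exists_forall_le hlim
  have hfix : ∀ h ∈ M, h x = x := by
    intro h hh
    by_contra hxy
    have hy : F (h x) ≤ F x := by
      obtain ⟨e, he, h1⟩ := hFatt (h x)
      rw [h1]
      exact hFle x (e * h) (M.mul_mem he hh)
    obtain ⟨e, he, h1⟩ := hFatt ((1/2 : ℝ) • x + (1/2 : ℝ) • h x)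
    have h2 : φ (e ((1/2 : ℝ) • x + (1/2 : ℝ) • h x))
        = (1/2 : ℝ) • φ (e x) + (1/2 : ℝ) • φ (e (h x)) := by
      rw [← map_smul φ, ← map_smul φ, ← map_add φ]
      congr 1
      rw [happ e (_ + _), happ e x, happ e (h x), map_add, map_smul, map_smul]
      module
    have h3 : φ (e x) ≠ φ (e (h x)) := fun h4 => hxy (e.injective (φ.injective h4)).symm
    have h5 := norm_combo_lt_of_ne (hFle x e he) ((hFle (h x) e he).trans hy) h3
      (a := 1/2) (b := 1/2) (by norm_num) (by norm_num) (by norm_num)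
    rw [← h2, ← h1] at h5
    exact absurd (hx _) (not_le.mpr h5)
  have hx0 : x = 0 := by
    have : x ∈ {x : W | ∀ c ∈ C, c x = x} := fun c hc => hfix _ (hCM c hc)
    rw [hC] at this
    exact this
  intro e he
  refine ⟨e.linear, ?_⟩
  ext y
  have h0 := hfix e he
  rw [hx0] at h0
  rw [happ e y, h0, add_zero]
  rfl
end

section
/- Let k be a field, V a k-vector space, and H a group acting on V by k-linear automorphisms. Let v ∈ V, let W ⊆ V be an H-invariant linear subspace, and let π : V → W be an H-equivariant linear projection onto W (π(x) ∈ W for all x, π restricted to W is the identity, and π(h • x) = h • π(x) for all h ∈ H, x ∈ V). If v + w ∈ H • v for every w ∈ W, then W = {0}. -/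
/-- Let `H` act on a `k`-vector space `V` by linear automorphisms, `v ∈ V`,
`W` an `H`-invariant subspace and `π : V → W` an `H`-equivariant linear projection onto `W`.
If `v + w ∈ H • v` for every `w ∈ W`, then `W = 0`. -/
theorem stmt4 {k V H : Type*} [Field k] [AddCommGroup V] [Module k V] [Group H]
    (ρ : H →* (V ≃ₗ[k] V)) (v : V) (W : Submodule k V)
    (hW : ∀ (h : H), ∀ x ∈ W, ρ h x ∈ W)
    (π : V →ₗ[k] V)
    (hπW : ∀ x : V, π x ∈ W)
    (hπid : ∀ x ∈ W, π x = x)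
    (hπequiv : ∀ (h : H) (x : V), π (ρ h x) = ρ h (π x))
    (horb : ∀ w ∈ W, ∃ h : H, ρ h v = v + w) :
    W = ⊥ := by
  have key : ∀ w ∈ W, ∃ h : H, ρ h (π v) = π v + w := by
    intro w hw
    obtain ⟨h, hh⟩ := horb w hw
    exact ⟨h, by rw [← hπequiv, hh, map_add, hπid w hw]⟩
  have h0 : π v = 0 := by
    obtain ⟨h, hh⟩ := key (-π v) (W.neg_mem (hπW v))
    rw [add_neg_cancel] at hh
    exact (LinearEquiv.map_eq_zero_iff (ρ h)).1 hh
  rw [Submodule.eq_bot_iff]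
  intro w hw
  obtain ⟨h, hh⟩ := key w hw
  rw [h0, map_zero, zero_add] at hh
  exact hh.symm
end

section
/- Fix integers n, r ≥ 1, a map a from {1,…,n} to ℤ^r whose values a(1),…,a(n) are pairwise distinct and all nonzero, and a vector v ∈ ℂⁿ all of whose coordinates v_i are nonzero. Let O = { (λ^{a(1)} v₁, …, λ^{a(n)} v_n) : λ ∈ (ℂˣ)^r } ⊆ ℂⁿ, where λ^{a(i)} = ∏_{m=1}^{r} λ_m^{a(i)_m}. Suppose A is an invertible n × n complex matrix and c ∈ ℂⁿ are such that the affine map T(x) = A x + c maps O onto O. Then c = 0, i.e., T is linear. -/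
open scoped BigOperators

open Polynomial in
lemma aux_mono (p : ℂ[X]) (h : ∀ t : ℂ, t ≠ 0 → p.eval t ≠ 0) :
    ∃ b k, p = C b * X ^ k := by
  have hp : p ≠ 0 := by
    rintro rfl
    exact h 1 one_ne_zero (by simp)
  have hr : p.roots = Multiset.replicate p.roots.card 0 := by
    rw [Multiset.eq_replicate]
    refine ⟨rfl, fun t ht => ?_⟩
    by_contra h0
    exact h t h0 ((mem_roots hp).1 ht)
  refine ⟨p.leadingCoeff, p.roots.card, ?_⟩
  have := (IsAlgClosed.splits p).eq_prod_roots
  rw [hr] at this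
  simpa using this

open Polynomial in
lemma aux_dir {J : Type} [Fintype J] (r : ℕ) (b : J → Fin r → ℤ) (hb : Function.Injective b) :
    ∃ w : Fin r → ℤ, Function.Injective (fun j => ∑ m, w m * b j m) := by
  classical
  let D : (Fin r → ℤ) → ℤ[X] := fun d => ∑ m : Fin r, C (d m) * X ^ (m : ℕ)
  have hD : ∀ d, d ≠ 0 → D d ≠ 0 := by
    intro d hd h0
    apply hd
    funext m
    have := congrArg (fun q => coeff q (m : ℕ)) h0
    simpa [D, finset_sum_coeff, coeff_X_pow, Fin.val_inj] using this
  let Q : ℤ[X] := ∏ p : J × J, if p.1 = p.2 then 1 else D (b p.1 - b p.2)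
  have hQ : Q ≠ 0 := by
    refine Finset.prod_ne_zero_iff.2 fun p _ => ?_
    split_ifs with h
    · exact one_ne_zero
    · exact hD _ (sub_ne_zero.2 fun h' => h (hb h'))
  obtain ⟨B, hB⟩ : ∃ B : ℤ, Q.eval B ≠ 0 := by
    by_contra! h
    exact hQ (Polynomial.funext (by simpa using h))
  refine ⟨fun m => B ^ (m : ℕ), fun i j hij => ?_⟩
  by_contra hne
  rw [eval_prod, Finset.prod_ne_zero_iff] at hB
  have := hB (i, j) (Finset.mem_univ _)
  simp only [hne, if_false, D, eval_finset_sum] at this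
  apply this
  have h2 := sub_eq_zero.2 hij
  simp only [← Finset.sum_sub_distrib] at h2
  rw [← h2]
  refine Finset.sum_congr rfl fun m _ => ?_
  simp
  ring

open Polynomial in
lemma aux_laurent {J : Type} [Fintype J] (k : J → ℤ) (hk : Function.Injective k) (β : J → ℂ)
    (h : ∀ t : ℂ, t ≠ 0 → ∑ j, β j * t ^ k j ≠ 0) (i j : J) (hi : β i ≠ 0) (hj : β j ≠ 0) :
    i = j := by
  classical
  let N : ℕ := ∑ j, (k j).natAbs
  have hN : ∀ j, 0 ≤ k j + N := by
    intro j
    have : (k j).natAbs ≤ N :=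
      Finset.single_le_sum (f := fun j => (k j).natAbs) (fun _ _ => Nat.zero_le _)
        (Finset.mem_univ j)
    omega
  let e : J → ℕ := fun j => (k j + N).toNat
  have he : ∀ j, (e j : ℤ) = k j + N := fun j => Int.toNat_of_nonneg (hN j)
  have hinj : Function.Injective e := by
    intro x y hxy
    apply hk
    have := he x
    have := he y
    rw [hxy] at *
    omega
  let p : ℂ[X] := ∑ j, C (β j) * X ^ e j
  have hc : ∀ j, p.coeff (e j) = β j := by
    intro j
    simp [p, finset_sum_coeff, coeff_X_pow, hinj.eq_iff]
  obtain ⟨b, d, hp⟩ := aux_mono p (by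
    intro t ht
    have : p.eval t = (∑ j, β j * t ^ k j) * t ^ N := by
      simp only [p, eval_finset_sum, Finset.sum_mul]
      refine Finset.sum_congr rfl fun j _ => ?_
      rw [mul_assoc, ← zpow_natCast t N, ← zpow_add₀ ht, ← he, zpow_natCast]
      simp
    rw [this]
    exact mul_ne_zero (h t ht) (pow_ne_zero _ ht))
  have key : ∀ j, β j ≠ 0 → e j = d := by
    intro j hj
    by_contra hne
    apply hj
    rw [← hc, hp]
    simp [coeff_X_pow, hne]
  exact hinj ((key i hi).trans (key j hj).symm)

/-- Let `O ⊆ ℂⁿ` be the orbit of a vector `v` with all coordinates nonzero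
under the torus `(ℂˣ)ʳ` acting diagonally with pairwise distinct nonzero integer weights
`a 1, …, a n`.  If an affine map `x ↦ A x + c` (with `A` invertible) maps `O` onto `O`,
then `c = 0`. -/
theorem stmt6 (n r : ℕ) (hn : 1 ≤ n) (hr : 1 ≤ r)
    (a : Fin n → Fin r → ℤ) (hinj : Function.Injective a) (hnz : ∀ i, a i ≠ 0)
    (v : Fin n → ℂ) (hv : ∀ i, v i ≠ 0)
    (A : Matrix (Fin n) (Fin n) ℂ) (hA : IsUnit A) (c : Fin n → ℂ)
    (hT : (fun x => A.mulVec x + c) ''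
        {x : Fin n → ℂ | ∃ l : Fin r → ℂˣ, ∀ i, x i = (∏ m, (l m : ℂ) ^ (a i m)) * v i} =
        {x : Fin n → ℂ | ∃ l : Fin r → ℂˣ, ∀ i, x i = (∏ m, (l m : ℂ) ^ (a i m)) * v i}) :
    c = 0 := by
  classical
  funext i
  by_contra hci
  simp only [Pi.zero_apply] at hci
  obtain ⟨j, hj⟩ : ∃ j, A i j ≠ 0 := by
    by_contra! h
    have hd := (Matrix.isUnit_iff_isUnit_det A).1 hA
    rw [Matrix.det_eq_zero_of_row_eq_zero i h] at hd
    exact not_isUnit_zero hd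
  let b : Option (Fin n) → Fin r → ℤ := fun o => o.elim 0 a
  have hb : Function.Injective b := by
    rintro (_ | x) (_ | y) hxy
    · rfl
    · exact absurd hxy.symm (hnz y)
    · exact absurd hxy (hnz x)
    · exact congrArg some (hinj hxy)
  obtain ⟨w, hw⟩ := aux_dir r b hb
  let β : Option (Fin n) → ℂ := fun o => o.elim (c i) (fun j => A i j * v j)
  have := aux_laurent _ hw β (by
    intro t ht
    have hpow : ∀ x, ∏ m, (((Units.mk0 t ht) ^ (w m) : ℂˣ) : ℂ) ^ (a x m)
        = t ^ (∑ m, w m * a x m) := by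
      intro x
      have hs : ∀ s : Finset (Fin r), ∏ m ∈ s, t ^ (w m * a x m) = t ^ (∑ m ∈ s, w m * a x m) := by
        intro s
        induction s using Finset.induction_on with
        | empty => simp
        | insert m s hm ih => rw [Finset.prod_insert hm, Finset.sum_insert hm, zpow_add₀ ht, ih]
      rw [← hs]
      refine Finset.prod_congr rfl fun m _ => ?_
      rw [zpow_mul]
      simp
    have hmem := hT.subset ⟨fun x => t ^ (∑ m, w m * a x m) * v x,
      ⟨fun m => (Units.mk0 t ht) ^ (w m), fun x => by rw [hpow]⟩, rfl⟩
    obtain ⟨l, hl⟩ := hmem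
    have hli := hl i
    have hne : (∏ m, (l m : ℂ) ^ (a i m)) * v i ≠ 0 :=
      mul_ne_zero (Finset.prod_ne_zero_iff.2 fun m _ => zpow_ne_zero _ (l m).ne_zero) (hv i)
    rw [← hli] at hne
    convert hne using 1
    rw [Fintype.sum_option]
    simp only [β, b, Option.elim, Pi.add_apply, Matrix.mulVec, dotProduct, Pi.zero_apply,
      mul_zero, Finset.sum_const_zero, zpow_zero, mul_one]
    rw [add_comm]
    congr 1
    refine Finset.sum_congr rfl fun x _ => ?_
    ring) none (some j) hci (mul_ne_zero hj (hv j))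
  exact absurd this (by simp)
end

section
/- Fix integers n, r ≥ 1, a map a from {1,…,n} to ℤ^r whose values a(1),…,a(n) are pairwise distinct and all nonzero, and a vector v ∈ ℂⁿ all of whose coordinates v_i are nonzero. Let O = { (λ^{a(1)} v₁, …, λ^{a(n)} v_n) : λ ∈ (ℂˣ)^r } ⊆ ℂⁿ, where λ^{a(i)} = ∏_{m=1}^{r} λ_m^{a(i)_m}. Suppose A is an invertible n × n complex matrix such that the linear map x ↦ A x maps O onto O. Then: (i) for each row index i there is exactly one column index j with A_{ij} ≠ 0; and (ii) there exist an integer k ≥ 1 and λ ∈ (ℂˣ)^r such that A^k is the diagonal matrix with diagonal entries λ^{a(1)}, …, λ^{a(n)}. -/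
open scoped BigOperators

/-- A one-variable Laurent polynomial without zeros on the punctured plane is a monomial. -/
lemma one_var {n : ℕ} (c : Fin n → ℂ) (e : Fin n → ℤ) (he : Function.Injective e)
    (h : ∀ t : ℂ, t ≠ 0 → ∑ j, c j * t ^ (e j) ≠ 0) : ∃! j, c j ≠ 0 := by
  have hex : ∃ j, c j ≠ 0 := by
    by_contra hc
    push Not at hc
    exact h 1 one_ne_zero (by simp [hc])
  obtain ⟨M, hM⟩ : ∃ M : ℤ, ∀ j, 0 ≤ e j + M := by
    refine ⟨∑ j, |e j|, fun j => ?_⟩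
    have h1 : |e j| ≤ ∑ j, |e j| :=
      Finset.single_le_sum (f := fun j => |e j|) (fun i _ => abs_nonneg _) (Finset.mem_univ j)
    have h2 := neg_abs_le (e j)
    linarith
  choose d hd using fun j => Int.eq_ofNat_of_zero_le (hM j)
  have hdinj : Function.Injective d := by
    intro i j hij
    apply he
    have h1 := hd i
    have h2 := hd j
    rw [hij] at h1
    linarith
  set P : Polynomial ℂ := ∑ j, Polynomial.monomial (d j) (c j) with hP
  have hcoeff : ∀ j, P.coeff (d j) = c j := by
    intro j
    rw [hP, Polynomial.finset_sum_coeff, Finset.sum_eq_single j]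
    · simp
    · intro b _ hb
      rw [Polynomial.coeff_monomial, if_neg (fun hh => hb (hdinj hh))]
    · simp
  have heval : ∀ t : ℂ, t ≠ 0 → P.eval t ≠ 0 := by
    intro t ht h0
    apply h t ht
    have h1 : P.eval t = t ^ M * ∑ j, c j * t ^ (e j) := by
      rw [hP, Polynomial.eval_finset_sum, Finset.mul_sum]
      refine Finset.sum_congr rfl fun j _ => ?_
      rw [Polynomial.eval_monomial, ← zpow_natCast]
      have := hd j
      rw [show ((d j : ℕ) : ℤ) = e j + M from this.symm, zpow_add₀ ht]
      ring
    rw [h0] at h1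
    exact (mul_eq_zero.mp h1.symm).resolve_left (zpow_ne_zero _ ht)
  have hP0 : P ≠ 0 := by
    intro hh
    exact heval 1 one_ne_zero (by simp [hh])
  obtain ⟨Q, hQ, hnd⟩ := Polynomial.exists_eq_pow_rootMultiplicity_mul_and_not_dvd P hP0 0
  set k := P.rootMultiplicity 0
  have hQdeg : Q.degree = 0 := by
    by_contra hdeg
    obtain ⟨z, hz⟩ := IsAlgClosed.exists_root Q hdeg
    by_cases hz0 : z = 0
    · subst hz0
      exact hnd (Polynomial.dvd_iff_isRoot.mpr hz)
    · apply heval z hz0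
      rw [hQ, Polynomial.eval_mul, hz.eq_zero, mul_zero]
  have hQC := Polynomial.eq_C_of_degree_eq_zero hQdeg
  have hk : ∀ j, c j ≠ 0 → d j = k := by
    intro j hj
    by_contra hne
    apply hj
    rw [← hcoeff j, hQ, hQC]
    simp [Polynomial.coeff_X_pow, hne]
  obtain ⟨j, hj⟩ := hex
  exact ⟨j, hj, fun i hi => hdinj ((hk i hi).trans (hk j hj).symm)⟩

/-- There is an integer direction separating finitely many distinct integer vectors. -/
lemma exists_sep {n r : ℕ} (a : Fin n → Fin r → ℤ) (hinj : Function.Injective a) :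
    ∃ w : Fin r → ℤ, Function.Injective (fun j => ∑ m, w m * a j m) := by
  let p : Fin n → Polynomial ℤ := fun j => ∑ m : Fin r, Polynomial.monomial (m : ℕ) (a j m)
  have hp : Function.Injective p := by
    intro i j hij
    apply hinj
    funext m
    have hc : ∀ i, (p i).coeff (m : ℕ) = a i m := by
      intro i
      simp only [p, Polynomial.finset_sum_coeff, Polynomial.coeff_monomial]
      rw [Finset.sum_eq_single m]
      · simp
      · intro b _ hb
        rw [if_neg (fun hh => hb (Fin.ext hh))]
      · simp
    rw [← hc i, ← hc j, hij]
  let R : Polynomial ℤ := ∏ x : Fin n × Fin n, if x.1 = x.2 then 1 else p x.1 - p x.2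
  have hR : R ≠ 0 := by
    refine Finset.prod_ne_zero_iff.mpr fun x _ => ?_
    split_ifs with hx
    · exact one_ne_zero
    · exact sub_ne_zero.mpr fun hh => hx (hp hh)
  obtain ⟨b, hb⟩ : ∃ b : ℤ, R.eval b ≠ 0 := by
    by_contra hc
    push Not at hc
    exact hR (Polynomial.funext fun b => by simp [hc b])
  refine ⟨fun m => b ^ (m : ℕ), fun i j hij => ?_⟩
  by_contra hne
  apply hb
  simp only [R, Polynomial.eval_prod]
  refine Finset.prod_eq_zero (Finset.mem_univ (i, j)) ?_
  have hpe : ∀ i, (p i).eval b = ∑ m : Fin r, b ^ (m : ℕ) * a i m := by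
    intro i
    simp only [p, Polynomial.eval_finset_sum, Polynomial.eval_monomial]
    exact Finset.sum_congr rfl fun m _ => mul_comm _ _
  simp only [if_neg hne, Polynomial.eval_sub, hpe]
  exact sub_eq_zero.mpr hij

lemma zpow_sum_aux {r : ℕ} (t : ℂ) (ht : t ≠ 0) (f : Fin r → ℤ) :
    t ^ (∑ m, f m) = ∏ m, t ^ (f m) := by
  classical
  have : ∀ s : Finset (Fin r), t ^ (∑ m ∈ s, f m) = ∏ m ∈ s, t ^ (f m) := by
    intro s
    induction s using Finset.induction_on with
    | empty => simp
    | insert x s hx ih => rw [Finset.sum_insert hx, Finset.prod_insert hx, zpow_add₀ ht, ih]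
  exact this _

lemma multi_var {n r : ℕ} (a : Fin n → Fin r → ℤ) (hinj : Function.Injective a)
    (c : Fin n → ℂ) (h : ∀ l : Fin r → ℂˣ, ∑ j, c j * ∏ m, (l m : ℂ) ^ (a j m) ≠ 0) :
    ∃! j, c j ≠ 0 := by
  obtain ⟨w, hw⟩ := exists_sep a hinj
  refine one_var c _ hw fun t ht => ?_
  have h1 := h (fun m => (Units.mk0 t ht) ^ (w m))
  convert h1 using 3 with j
  simp only [Units.val_zpow_eq_zpow_val, Units.val_mk0, ← zpow_mul]
  exact zpow_sum_aux t ht _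

/-- Let `O ⊆ ℂⁿ` be the orbit of a vector `v` with all coordinates nonzero
under the torus `(ℂˣ)ʳ` acting diagonally with pairwise distinct nonzero integer weights.
If an invertible matrix `A` maps `O` onto `O`, then each row of `A` has exactly one nonzero
entry, and some positive power of `A` is a diagonal matrix lying in the image of the torus. -/
theorem stmt7 (n r : ℕ) (hn : 1 ≤ n) (hr : 1 ≤ r)
    (a : Fin n → Fin r → ℤ) (hinj : Function.Injective a) (hnz : ∀ i, a i ≠ 0)
    (v : Fin n → ℂ) (hv : ∀ i, v i ≠ 0)
    (A : Matrix (Fin n) (Fin n) ℂ) (hA : IsUnit A)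
    (hT : (fun x => A.mulVec x) ''
        {x : Fin n → ℂ | ∃ l : Fin r → ℂˣ, ∀ i, x i = (∏ m, (l m : ℂ) ^ (a i m)) * v i} =
        {x : Fin n → ℂ | ∃ l : Fin r → ℂˣ, ∀ i, x i = (∏ m, (l m : ℂ) ^ (a i m)) * v i}) :
    (∀ i : Fin n, ∃! j : Fin n, A i j ≠ 0) ∧
    ∃ k : ℕ, 1 ≤ k ∧ ∃ l : Fin r → ℂˣ,
      A ^ k = Matrix.diagonal (fun i => ∏ m, (l m : ℂ) ^ (a i m)) := by
  classical
  set O := {x : Fin n → ℂ | ∃ l : Fin r → ℂˣ, ∀ i, x i = (∏ m, (l m : ℂ) ^ (a i m)) * v i}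
    with hO
  have hmap : ∀ x ∈ O, A.mulVec x ∈ O := fun x hx => by
    rw [← hT]
    exact ⟨x, hx, rfl⟩
  have hrow : ∀ i : Fin n, ∃! j : Fin n, A i j ≠ 0 := by
    intro i
    have h1 := multi_var a hinj (fun j => A i j * v j) (by
      intro l
      obtain ⟨l', hl'⟩ := hmap (fun i => (∏ m, (l m : ℂ) ^ (a i m)) * v i) ⟨l, fun i => rfl⟩
      have h2 := hl' i
      simp only [Matrix.mulVec, dotProduct] at h2
      have h3 : ∑ j, A i j * v j * ∏ m, (l m : ℂ) ^ (a j m)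
          = ∑ j, A i j * ((∏ m, (l m : ℂ) ^ (a j m)) * v j) :=
        Finset.sum_congr rfl fun j _ => by ring
      rw [h3, h2]
      exact mul_ne_zero (Finset.prod_ne_zero_iff.mpr fun m _ =>
        zpow_ne_zero _ (Units.ne_zero _)) (hv i))
    simpa [hv] using h1
  refine ⟨hrow, ?_⟩
  choose s hs hsu using hrow
  have hsurj : Function.Surjective s := by
    intro j
    by_contra hj
    push Not at hj
    have h1 : A.mulVec (Pi.single j 1) = A.mulVec 0 := by
      funext i
      simp only [Matrix.mulVec_single_one, Matrix.mulVec_zero, Pi.zero_apply, Matrix.col_apply]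
      by_contra hne
      exact hj i (hsu i j hne).symm
    have h2 := Matrix.mulVec_injective_iff_isUnit.mpr hA h1
    have h3 := congrFun h2 j
    simp at h3
  let σ : Equiv.Perm (Fin n) := Equiv.ofBijective s (Finite.surjective_iff_bijective.mp hsurj)
  have hzero : ∀ i j, j ≠ σ i → A i j = 0 := by
    intro i j hj
    by_contra hne
    exact hj (hsu i j hne)
  have hpow : ∀ k : ℕ, ∀ i j, j ≠ (σ ^ k) i → (A ^ k) i j = 0 := by
    intro k
    induction k with
    | zero =>
      intro i j hj
      simp only [pow_zero, Equiv.Perm.coe_one, id_eq] at hj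
      simp [Matrix.one_apply, hj.symm]
    | succ k ih =>
      intro i j hj
      rw [pow_succ, Matrix.mul_apply]
      refine Finset.sum_eq_zero fun x _ => ?_
      by_cases hx : x = (σ ^ k) i
      · rw [hzero x j, mul_zero]
        rw [hx]
        rwa [pow_succ', Equiv.Perm.mul_apply] at hj
      · rw [ih i x hx, zero_mul]
  have hpO : ∀ k : ℕ, (A ^ k).mulVec v ∈ O := by
    intro k
    induction k with
    | zero => exact ⟨1, fun i => by simp⟩
    | succ k ih =>
      rw [pow_succ', ← Matrix.mulVec_mulVec]
      exact hmap _ ih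
  refine ⟨orderOf σ, orderOf_pos σ, ?_⟩
  obtain ⟨l, hl⟩ := hpO (orderOf σ)
  have hz := hpow (orderOf σ)
  rw [pow_orderOf_eq_one] at hz
  refine ⟨l, ?_⟩
  ext i j
  by_cases hij : i = j
  · subst hij
    rw [Matrix.diagonal_apply_eq]
    have h1 := hl i
    simp only [Matrix.mulVec, dotProduct] at h1
    rw [Finset.sum_eq_single i] at h1
    · exact mul_right_cancel₀ (hv i) h1
    · intro b _ hb
      rw [hz i b (by simpa using hb), zero_mul]
    · simp
  · rw [Matrix.diagonal_apply_ne _ hij]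
    exact hz i j (by simpa using Ne.symm hij)
end

section
/- Let H be a group acting linearly on a finite-dimensional complex vector space V such that V is a semisimple H-module (every H-invariant subspace of V admits an H-invariant complement), and let v ∈ V. Then the linear span of the orbit H • v equals V if and only if every group homomorphism σ : ℂˣ → GL(V) whose image commutes with the action of every element of H and which satisfies σ(t) v = v for all t ∈ ℂˣ is trivial (σ(t) = id_V for all t). -/
/-- Let `H` act linearly on a finite-dimensional complex vector space `V`
with `V` a semisimple `H`-module, and let `v ∈ V`.  Then the span of the orbit `H • v` is all
of `V` iff every group homomorphism `σ : ℂˣ → GL(V)` commuting with the `H`-action and fixing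
`v` is trivial. -/
theorem stmt8 {H V : Type*} [Group H] [AddCommGroup V] [Module ℂ V] [FiniteDimensional ℂ V]
    (ρ : H →* (V ≃ₗ[ℂ] V))
    (hss : ∀ W : Submodule ℂ V, (∀ (h : H), ∀ x ∈ W, ρ h x ∈ W) →
      ∃ W' : Submodule ℂ V, (∀ (h : H), ∀ x ∈ W', ρ h x ∈ W') ∧ IsCompl W W')
    (v : V) :
    Submodule.span ℂ (Set.range fun h : H => ρ h v) = ⊤ ↔
      ∀ σ : ℂˣ →* (V ≃ₗ[ℂ] V),
        (∀ (t : ℂˣ) (h : H) (x : V), σ t (ρ h x) = ρ h (σ t x)) →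
        (∀ t : ℂˣ, σ t v = v) →
        ∀ (t : ℂˣ) (x : V), σ t x = x := by
  constructor
  · intro hspan σ hc hv t x
    have hx : x ∈ Submodule.span ℂ (Set.range fun h : H => ρ h v) := hspan ▸ Submodule.mem_top
    induction hx using Submodule.span_induction with
    | mem y hy =>
      obtain ⟨h, rfl⟩ := hy
      simp only [hc, hv]
    | zero => simp
    | add y z _ _ hy hz => rw [map_add, hy, hz]
    | smul a y _ hy => rw [map_smul, hy]
  · intro hσ
    set W := Submodule.span ℂ (Set.range fun h : H => ρ h v) with hW
    have hWinv : ∀ (h : H), ∀ x ∈ W, ρ h x ∈ W := by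
      intro h x hx
      induction hx using Submodule.span_induction with
      | mem y hy =>
        obtain ⟨g, rfl⟩ := hy
        refine Submodule.subset_span ⟨h * g, ?_⟩
        simp
      | zero => simp
      | add y z _ _ hy hz => rw [map_add]; exact W.add_mem hy hz
      | smul a y _ hy => rw [map_smul]; exact W.smul_mem a hy
    obtain ⟨W', hW'inv, hcompl⟩ := hss W hWinv
    obtain ⟨p, hp1, hp2, hpW⟩ : ∃ p : Module.End ℂ V, (∀ x ∈ W, p x = x) ∧
        (∀ x ∈ W', p x = 0) ∧ ∀ x, p x ∈ W := by
      refine ⟨W.subtype ∘ₗ Submodule.projectionOnto W W' hcompl, ?_, ?_, ?_⟩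
      · intro x hx
        have := Submodule.projectionOnto_apply_left hcompl ⟨x, hx⟩
        exact congrArg Subtype.val this
      · intro x hx
        have := Submodule.projectionOnto_apply_right hcompl ⟨x, hx⟩
        exact congrArg Subtype.val this
      · intro x
        simp
    have hpc : ∀ (h : H) (x : V), p (ρ h x) = ρ h (p x) := by
      intro h x
      have hx : x ∈ W ⊔ W' := hcompl.sup_eq_top ▸ Submodule.mem_top
      obtain ⟨a, ha, b, hb, rfl⟩ := Submodule.mem_sup.1 hx
      simp only [map_add, hp1 a ha, hp2 b hb, hp1 _ (hWinv h a ha), hp2 _ (hW'inv h b hb), map_zero]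
    let f : ℂˣ →* Module.End ℂ V :=
      { toFun := fun t => p + (t : ℂ) • (1 - p)
        map_one' := by simp
        map_mul' := by
          intro s t
          ext x
          have := hp1 _ (hpW x)
          simp only [LinearMap.add_apply, LinearMap.smul_apply, LinearMap.sub_apply,
            Module.End.mul_apply, Module.End.one_apply, map_add, map_sub, map_smul, this,
            Units.val_mul]
          module }
    let σ : ℂˣ →* (V ≃ₗ[ℂ] V) :=
      (LinearMap.GeneralLinearGroup.generalLinearEquiv ℂ V).toMonoidHom.comp f.toHomUnits
    have hσa : ∀ t x, σ t x = p x + (t : ℂ) • (x - p x) := fun t x => rfl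
    have hvW : v ∈ W := Submodule.subset_span ⟨1, by simp⟩
    have key := hσ σ (by intro t h x; simp [hσa, hpc]) (by intro t; simp [hσa, hp1 v hvW])
      (Units.mk0 2 two_ne_zero)
    rw [eq_top_iff]
    intro x _
    have hx := key x
    rw [hσa] at hx
    simp only [Units.val_mk0] at hx
    have h0 : p x = x := by
      have : p x - x = 0 := by
        calc p x - x = x - (p x + (2 : ℂ) • (x - p x)) := by module
          _ = 0 := by rw [hx, sub_self]
      exact sub_eq_zero.1 this
    rw [← h0]
    exact hpW x
end

section
/- Let p, s, l be natural numbers with l ≥ 2s. Then for every natural number m with 0 ≤ m ≤ s, the following identity holds in ℚ: Σ_{j=0}^{s} [C(j, m) · C(s, j) · C(p, s−j) · C(l−s+j, j−m)] / [C(l+p+1−s+j, s−j) · C(l+p−2s+2j, j−m)] = C(s, m), where C(·,·) denotes the binomial coefficient. (Since l ≥ 2s, all the arguments l−s+j, l+p−2s+2j and l+p+1−s+j are genuine natural numbers and both binomial coefficients in each denominator are nonzero; terms with j < m vanish because C(j, m) = 0.) -/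
open scoped BigOperators

/-- The WZ summand (without the global factor `n!`). -/
def wzF (n B p i : ℕ) : ℚ :=
  (p.choose (n - i) : ℚ) * ((B + n + i).choose i : ℚ) * (B + p + 1 + 2 * i) *
    ((B + p + i).factorial : ℚ) / ((B + n + p + 1 + i).factorial : ℚ)

/-- The WZ mate. -/
def wzG (n B p i : ℕ) : ℚ :=
  (i : ℚ) * (p.choose (n - i) : ℚ) * ((B + n + i).choose i : ℚ) *
    ((B + p + i).factorial : ℚ) / ((B + n + p + 1 + i).factorial : ℚ)

lemma wz_step (n B p i : ℕ) (hi : i < n) :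
    wzF n B (p + 1) i - wzF n B p i = wzG n B p (i + 1) - wzG n B p i := by
  obtain ⟨k, rfl⟩ : ∃ k, n = i + (k + 1) := ⟨n - i - 1, by omega⟩
  have h1 : i + (k + 1) - i = k + 1 := by omega
  have h2 : i + (k + 1) - (i + 1) = k := by omega
  have hx : ((p.choose (k + 1) : ℕ) : ℚ) * (k + 1) = (p.choose k : ℚ) * (p - k) := by
    rcases le_or_gt k p with h | h
    · have := Nat.choose_succ_right_eq p k
      rw [← Nat.cast_sub h]
      exact_mod_cast this
    · simp [Nat.choose_eq_zero_of_lt h, Nat.choose_eq_zero_of_lt (show p < k + 1 by omega)]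
  have hA : (((B + (i + (k + 1)) + i + 1).choose (i + 1) : ℕ) : ℚ) * (i + 1)
      = (B + (i + (k + 1)) + i + 1) * ((B + (i + (k + 1)) + i).choose i : ℚ) := by
    have := Nat.add_one_mul_choose_eq (B + (i + (k + 1)) + i) i
    exact_mod_cast this.symm
  have e1 : B + (p + 1) + i = B + p + i + 1 := by ring
  have e2 : B + p + (i + 1) = B + p + i + 1 := by ring
  have e3 : B + (i + (k + 1)) + (p + 1) + 1 + i = B + (i + (k + 1)) + p + 1 + i + 1 := by ring
  have e4 : B + (i + (k + 1)) + p + 1 + (i + 1) = B + (i + (k + 1)) + p + 1 + i + 1 := by ring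
  have e5 : B + (i + (k + 1)) + (i + 1) = B + (i + (k + 1)) + i + 1 := by ring
  unfold wzF wzG
  rw [h1, h2, e1, e2, e3, e4, e5, Nat.choose_succ_succ p k, Nat.factorial_succ (B + p + i),
    Nat.factorial_succ (B + (i + (k + 1)) + p + 1 + i)]
  have hf : ((B + (i + (k + 1)) + p + 1 + i).factorial : ℚ) ≠ 0 := by positivity
  have hg : ((B : ℚ) + (i + (k + 1)) + p + 1 + i + 1) ≠ 0 := by positivity
  push_cast
  generalize ((B + (i + (k + 1)) + p + 1 + i).factorial : ℚ) = d at *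
  generalize ((B + p + i).factorial : ℚ) = f at *
  generalize (((B + (i + (k + 1)) + i + 1).choose (i + 1) : ℕ) : ℚ) = c' at *
  generalize (((B + (i + (k + 1)) + i).choose i : ℕ) : ℚ) = c at *
  generalize ((p.choose (k + 1) : ℕ) : ℚ) = y at *
  generalize ((p.choose k : ℕ) : ℚ) = x at *
  field_simp
  linear_combination (-(c * f * (B + p + i + 1))) * hx - (f * x * (B + p + i + 1)) * hA

lemma wz_last (n B p : ℕ) : wzF n B (p + 1) n - wzF n B p n = - wzG n B p n := by
  unfold wzF wzG
  have e1 : B + (p + 1) + n = B + p + n + 1 := by ring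
  have e3 : B + n + (p + 1) + 1 + n = B + n + p + 1 + n + 1 := by ring
  rw [e1, e3, Nat.factorial_succ (B + p + n), Nat.factorial_succ (B + n + p + 1 + n)]
  have hf : ((B + n + p + 1 + n).factorial : ℚ) ≠ 0 := by positivity
  have hg : ((B : ℚ) + n + p + 1 + n + 1) ≠ 0 := by positivity
  simp only [Nat.sub_self, Nat.choose_zero_right]
  push_cast
  field_simp
  ring

lemma wz_sum (n B p : ℕ) :
    ∑ i ∈ Finset.range (n + 1), (n.factorial : ℚ) * wzF n B p i = 1 := by
  induction p with
  | zero =>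
    rw [Finset.sum_range_succ, Finset.sum_eq_zero]
    · unfold wzF
      have e : B + n + n = n + (B + n) := by ring
      have e' : B + n + 0 + 1 + n = n + (B + n) + 1 := by ring
      rw [e, e', Nat.cast_add_choose, Nat.factorial_succ]
      have h1 : ((n + (B + n)).factorial : ℚ) ≠ 0 := by positivity
      have h2 : (n.factorial : ℚ) ≠ 0 := by positivity
      have h3 : ((B + n).factorial : ℚ) ≠ 0 := by positivity
      have hg : ((n : ℚ) + (B + n) + 1) ≠ 0 := by positivity
      simp only [Nat.sub_self, Nat.choose_zero_right, add_zero]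
      push_cast
      field_simp
      ring
    · intro i hi
      have hi := Finset.mem_range.1 hi
      simp [wzF, Nat.choose_eq_zero_of_lt (show 0 < n - i by omega)]
  | succ p ih =>
    rw [← ih, ← sub_eq_zero, ← Finset.sum_sub_distrib]
    simp_rw [← mul_sub]
    rw [← Finset.mul_sum, Finset.sum_range_succ, wz_last,
      Finset.sum_congr rfl (fun i hi => wz_step n B p i (Finset.mem_range.1 hi)),
      Finset.sum_range_sub]
    simp [wzG]

lemma wz_term (p m a i k : ℕ) :
    (((m + i).choose m : ℚ) * ((m + i + k).choose (m + i) : ℚ) * (p.choose k : ℚ) *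
          ((2 * m + a + (i + k) + i).choose i : ℚ)) /
        (((k + (2 * m + a + p + 1 + 2 * i)).choose k : ℚ) *
          ((i + (2 * m + a + p + i)).choose i : ℚ))
      = ((m + (i + k)).choose m : ℚ) * (((i + k).factorial : ℚ) * wzF (i + k) (2 * m + a) p i) := by
  unfold wzF
  have e : i + k - i = k := by omega
  have e1 : 2 * m + a + p + 1 + 2 * i = i + (2 * m + a + p + i) + 1 := by ring
  have e2 : 2 * m + a + (i + k) + p + 1 + i = k + (i + (2 * m + a + p + i) + 1) := by ring
  rw [e, e1, e2]
  simp only [Nat.cast_add_choose]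
  rw [Nat.factorial_succ (i + (2 * m + a + p + i)), show m + i + k = m + (i + k) by ring]
  generalize (((2 * m + a + (i + k) + i).choose i : ℕ) : ℚ) = c
  generalize ((p.choose k : ℕ) : ℚ) = y
  have := fun n : ℕ => (Nat.cast_ne_zero (R := ℚ)).2 n.factorial_ne_zero
  have h1 := this m
  have h2 := this i
  have h3 := this k
  have h4 := this (m + i)
  have h5 := this (i + k)
  have h6 := this (m + (i + k))
  have h7 := this (i + (2 * m + a + p + i))
  have h8 := this (2 * m + a + p + i)
  have h9 := this (k + (i + (2 * m + a + p + i) + 1))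
  have hg : ((i : ℚ) + (2 * m + a + p + i) + 1) ≠ 0 := by positivity
  push_cast
  field_simp
  ring

/-- The binomial identity solving the triangular system of Theorem 7.20:
for `l ≥ 2s` and `0 ≤ m ≤ s`,
`Σ_{j=0}^{s} C(j,m)·C(s,j)·C(p,s−j)·C(l−s+j,j−m) / (C(l+p+1−s+j,s−j)·C(l+p−2s+2j,j−m)) = C(s,m)`. -/
theorem stmt9 (p s l : ℕ) (hl : 2 * s ≤ l) (m : ℕ) (hm : m ≤ s) :
    ∑ j ∈ Finset.range (s + 1),
      ((j.choose m : ℚ) * (s.choose j : ℚ) * (p.choose (s - j) : ℚ) *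
          ((l - s + j).choose (j - m) : ℚ)) /
        (((l + p + 1 - s + j).choose (s - j) : ℚ) *
          ((l + p - 2 * s + 2 * j).choose (j - m) : ℚ)) = (s.choose m : ℚ) := by
  obtain ⟨n, rfl⟩ := Nat.exists_eq_add_of_le hm
  obtain ⟨a, rfl⟩ := Nat.exists_eq_add_of_le hl
  rw [add_assoc m n 1, Finset.sum_range_add, Finset.sum_eq_zero, zero_add]
  · rw [← mul_one ((m + n).choose m : ℚ), ← wz_sum n (2 * m + a) p, Finset.mul_sum]
    refine Finset.sum_congr rfl fun i hi => ?_
    have hi := Finset.mem_range.1 hi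
    obtain ⟨k, rfl⟩ : ∃ k, n = i + k := ⟨n - i, by omega⟩
    rw [← wz_term]
    have q1 : m + (i + k) - (m + i) = k := by omega
    have q2 : m + i - m = i := by omega
    have q3 : 2 * (m + (i + k)) + a - (m + (i + k)) + (m + i) = 2 * m + a + (i + k) + i := by omega
    have q4 : 2 * (m + (i + k)) + a + p + 1 - (m + (i + k)) + (m + i)
      = k + (2 * m + a + p + 1 + 2 * i) := by omega
    have q5 : 2 * (m + (i + k)) + a + p - 2 * (m + (i + k)) + 2 * (m + i)
      = i + (2 * m + a + p + i) := by omega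
    rw [q1, q2, q3, q4, q5, add_assoc m i k]
  · intro j hj
    simp [Nat.choose_eq_zero_of_lt (Finset.mem_range.1 hj)]
end

section
/- Let p, s, l be natural numbers with l ≥ 2s. Suppose c₀, c₁, …, c_s are rational numbers satisfying, for every natural number m with 0 ≤ m ≤ s, the equation Σ_{j=0}^{s} C(j, m) · c_j · C(l−s+j, j−m) / C(l+p−2s+2j, j−m) = C(s, m). Then necessarily c_j = C(s, j) · C(p, s−j) / C(l+p+1−s+j, s−j) for every j with 0 ≤ j ≤ s. -/
open scoped BigOperators

/-- Summand of the very-well-poised sum. -/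
def FF (n b p i : ℕ) : ℚ :=
  (n.choose i : ℚ) * (p.descFactorial (n - i) : ℚ) * ((b + n + 1).ascFactorial i : ℚ) *
    ((b : ℚ) + p + 2 * i + 1) / ((b + p + i + 1).ascFactorial (n + 1) : ℚ)

/-- Telescoping partner. -/
def GG (n b p i : ℕ) : ℚ :=
  (i : ℚ) * (n.choose i : ℚ) * (p.descFactorial (n - i) : ℚ) * ((b + n + 1).ascFactorial i : ℚ)
    / ((b + p + i + 1).ascFactorial (n + 1) : ℚ)

lemma desc_succ_q (p k : ℕ) :
    (p.descFactorial (k + 1) : ℚ) = ((p : ℚ) - k) * (p.descFactorial k : ℚ) := by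
  rw [Nat.descFactorial_succ]
  rcases le_or_gt k p with h | h
  · push_cast [Nat.cast_sub h]; ring
  · simp [Nat.descFactorial_eq_zero_iff_lt.2 h]

lemma asc_left_q (x n : ℕ) :
    (x.ascFactorial (n + 1) : ℚ) = (x : ℚ) * ((x + 1).ascFactorial n : ℚ) := by
  have := Nat.succ_ascFactorial x n
  rw [Nat.ascFactorial_succ]
  exact_mod_cast this.symm

lemma asc_right_q (x n : ℕ) :
    (x.ascFactorial (n + 1) : ℚ) = ((x : ℚ) + n) * (x.ascFactorial n : ℚ) := by
  rw [Nat.ascFactorial_succ]; push_cast; ring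

lemma asc_pos_q (x n : ℕ) : (0 : ℚ) < ((x + 1).ascFactorial n : ℚ) := by
  exact_mod_cast Nat.ascFactorial_pos x n

lemma step_lt (n b p i : ℕ) (h : i < n) :
    FF n b (p + 1) i - FF n b p i = GG n b p (i + 1) - GG n b p i := by
  obtain ⟨d, rfl⟩ : ∃ d, n = i + d + 1 := ⟨n - i - 1, by omega⟩
  have hch : ((i : ℚ) + 1) * ((i + d + 1).choose (i + 1) : ℚ)
      = ((d : ℚ) + 1) * ((i + d + 1).choose i : ℚ) := by
    have := Nat.choose_succ_right_eq (i + d + 1) i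
    rw [show i + d + 1 - i = d + 1 by omega] at this
    have h2 : (((i + d + 1).choose (i + 1) * (i + 1) : ℕ) : ℚ)
      = (((i + d + 1).choose i * (d + 1) : ℕ) : ℚ) := by rw [this]
    push_cast at h2; linarith
  unfold FF GG
  rw [show i + d + 1 - i = d + 1 by omega, show i + d + 1 - (i + 1) = d by omega,
    show b + (p + 1) + i + 1 = b + p + i + 1 + 1 by ring,
    show b + p + (i + 1) + 1 = b + p + i + 1 + 1 by ring,
    Nat.succ_descFactorial_succ, desc_succ_q p d, asc_left_q (b + p + i + 1),
    asc_right_q (b + p + i + 1 + 1), asc_right_q (b + (i + d + 1) + 1) i]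
  have hA := (asc_pos_q (b + p + i + 1) (i + d + 1)).ne'
  generalize ((b + p + i + 1 + 1).ascFactorial (i + d + 1) : ℚ) = A at *
  generalize ((b + (i + d + 1) + 1).ascFactorial i : ℚ) = B at *
  push_cast
  rw [hch]
  generalize ((i + d + 1).choose i : ℚ) = C at *
  generalize (p.descFactorial d : ℚ) = D at *
  have h1 : (b : ℚ) + p + i + 1 ≠ 0 := by positivity
  have h2 : (b : ℚ) + p + i + 1 + 1 + (i + d + 1) ≠ 0 := by positivity
  field_simp
  ring

lemma step_last (n b p : ℕ) : FF n b (p + 1) n - FF n b p n = - GG n b p n := by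
  unfold FF GG
  rw [show b + (p + 1) + n + 1 = b + p + n + 1 + 1 by ring,
    asc_left_q (b + p + n + 1), asc_right_q (b + p + n + 1 + 1)]
  have hA := (asc_pos_q (b + p + n + 1) n).ne'
  generalize ((b + p + n + 1 + 1).ascFactorial n : ℚ) = A at *
  generalize ((b + n + 1).ascFactorial n : ℚ) = B at *
  simp only [Nat.sub_self, Nat.descFactorial_zero, Nat.choose_self]
  push_cast
  have h1 : (b : ℚ) + p + n + 1 ≠ 0 := by positivity
  have h2 : (b : ℚ) + p + n + 1 + 1 + n ≠ 0 := by positivity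
  field_simp
  ring

lemma sum_FF (n b p : ℕ) : ∑ i ∈ Finset.range (n + 1), FF n b p i = 1 := by
  induction p with
  | zero =>
    rw [Finset.sum_range_succ, Finset.sum_eq_zero]
    · unfold FF
      rw [asc_right_q]
      have hA := (asc_pos_q (b + n) n).ne'
      have h1 : (b : ℚ) + n + 1 + n ≠ 0 := by positivity
      simp only [Nat.sub_self, Nat.descFactorial_zero, Nat.choose_self, Nat.add_zero]
      push_cast
      field_simp
      ring
    · intro i hi
      have hi := Finset.mem_range.1 hi
      unfold FF
      rw [Nat.descFactorial_eq_zero_iff_lt.2 (by omega : 0 < n - i)]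
      simp
  | succ p ih =>
    have key : ∑ i ∈ Finset.range (n + 1), (FF n b (p + 1) i - FF n b p i) = 0 := by
      rw [Finset.sum_range_succ, step_last,
        Finset.sum_congr rfl (fun i hi => step_lt n b p i (Finset.mem_range.1 hi)),
        Finset.sum_range_sub]
      simp [GG]
    rw [Finset.sum_sub_distrib, ih] at key
    linarith

lemma choose_asc_q (x k : ℕ) :
    ((x + k).choose k : ℚ) = ((x + 1).ascFactorial k : ℚ) / (k.factorial : ℚ) := by
  rw [Nat.ascFactorial_eq_factorial_mul_choose]
  have : (k.factorial : ℚ) ≠ 0 := by positivity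
  push_cast
  field_simp

lemma term_FF (n b p i : ℕ) (h : i ≤ n) :
    (n.choose i : ℚ) * (p.choose (n - i) : ℚ) / ((b + p + n + 1 + i).choose (n - i) : ℚ) *
      ((b + n + i).choose i : ℚ) / ((b + p + 2 * i).choose i : ℚ) = FF n b p i := by
  obtain ⟨d, rfl⟩ : ∃ d, n = i + d := ⟨n - i, by omega⟩
  have hD : (p.choose d : ℚ) = (p.descFactorial d : ℚ) / (d.factorial : ℚ) := by
    rw [Nat.descFactorial_eq_factorial_mul_choose]
    have : (d.factorial : ℚ) ≠ 0 := by positivity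
    push_cast
    field_simp
  unfold FF
  rw [show i + d - i = d by omega,
    show b + p + (i + d) + 1 + i = (b + p + 2 * i + 1) + d by ring,
    show b + p + 2 * i = (b + p + i) + i by ring, choose_asc_q, choose_asc_q, choose_asc_q, hD]
  have hs : ((b + p + i + 1).ascFactorial (i + d + 1) : ℚ) =
      ((b + p + i + 1).ascFactorial i : ℚ) * (((b : ℚ) + p + 2 * i + 1) *
        ((b + p + i + i + 1 + 1).ascFactorial d : ℚ)) := by
    have := Nat.ascFactorial_mul_ascFactorial (b + p + i + 1) i (d + 1)
    rw [show i + d + 1 = i + (d + 1) by ring, ← this]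
    push_cast
    rw [show b + p + i + 1 + i = b + p + i + i + 1 by ring, asc_left_q]
    push_cast; ring
  rw [hs]
  have h1 := (asc_pos_q (b + p + i) i).ne'
  have h2 := (asc_pos_q (b + p + i + i + 1) d).ne'
  have h3 : (b : ℚ) + p + 2 * i + 1 ≠ 0 := by positivity
  have h4 : (d.factorial : ℚ) ≠ 0 := by positivity
  have h5 : (i.factorial : ℚ) ≠ 0 := by positivity
  field_simp

lemma exist_half (p s l : ℕ) (hl : 2 * s ≤ l) (m : ℕ) (hm : m ≤ s) :
      ∑ j ∈ Finset.range (s + 1),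
        (j.choose m : ℚ) * ((s.choose j : ℚ) * (p.choose (s - j) : ℚ) /
        ((l + p + 1 - s + j).choose (s - j) : ℚ)) * ((l - s + j).choose (j - m) : ℚ) /
          ((l + p - 2 * s + 2 * j).choose (j - m) : ℚ) = (s.choose m : ℚ) := by
  obtain ⟨a, rfl⟩ : ∃ a, l = 2 * s + a := ⟨l - 2 * s, by omega⟩
  obtain ⟨n, rfl⟩ : ∃ n, s = m + n := ⟨s - m, by omega⟩
  rw [show m + n + 1 = m + (n + 1) by ring, Finset.sum_range_add, Finset.sum_eq_zero, zero_add]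
  · have := sum_FF n (a + 2 * m) p
    rw [← mul_one ((m + n).choose m : ℚ), ← this, Finset.mul_sum]
    refine Finset.sum_congr rfl fun i hi => ?_
    have hi : i ≤ n := by have := Finset.mem_range.1 hi; omega
    rw [← term_FF _ _ _ _ hi]
    have hc : ((m + n).choose (m + i) : ℚ) * ((m + i).choose m : ℚ)
        = ((m + n).choose m : ℚ) * (n.choose i : ℚ) := by
      have := Nat.choose_mul (n := m + n) (k := m + i) (s := m) (by omega)
      rw [show m + n - m = n by omega, show m + i - m = i by omega] at this
      exact_mod_cast this
    rw [show m + n - (m + i) = n - i by omega, show m + i - m = i by omega,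
      show 2 * (m + n) + a + p + 1 - (m + n) + (m + i) = a + 2 * m + p + n + 1 + i by omega,
      show 2 * (m + n) + a - (m + n) + (m + i) = a + 2 * m + n + i by omega,
      show 2 * (m + n) + a + p - 2 * (m + n) + 2 * (m + i) = a + 2 * m + p + 2 * i by omega]
    simp only [div_eq_mul_inv]
    linear_combination ((p.choose (n - i) : ℚ) * ((a + 2 * m + p + n + 1 + i).choose (n - i) : ℚ)⁻¹
      * ((a + 2 * m + n + i).choose i : ℚ) * ((a + 2 * m + p + 2 * i).choose i : ℚ)⁻¹) * hc
  · intro j hj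
    rw [Nat.choose_eq_zero_of_lt (Finset.mem_range.1 hj)]
    simp

/-- Uniqueness half of Theorem 7.20: if `c₀, …, c_s` solve the triangular
system `Σ_{j=0}^{s} C(j,m)·c_j·C(l−s+j,j−m)/C(l+p−2s+2j,j−m) = C(s,m)` for all `0 ≤ m ≤ s`,
then `c_j = C(s,j)·C(p,s−j)/C(l+p+1−s+j,s−j)` for all `0 ≤ j ≤ s`. -/
theorem stmt10 (p s l : ℕ) (hl : 2 * s ≤ l) (c : ℕ → ℚ)
    (hc : ∀ m : ℕ, m ≤ s →
      ∑ j ∈ Finset.range (s + 1),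
        (j.choose m : ℚ) * c j * ((l - s + j).choose (j - m) : ℚ) /
          ((l + p - 2 * s + 2 * j).choose (j - m) : ℚ) = (s.choose m : ℚ)) :
    ∀ j : ℕ, j ≤ s →
      c j = (s.choose j : ℚ) * (p.choose (s - j) : ℚ) /
        ((l + p + 1 - s + j).choose (s - j) : ℚ) := by
  have main : ∀ k j : ℕ, j ≤ s → s - j = k →
      c j = (s.choose j : ℚ) * (p.choose (s - j) : ℚ) /
        ((l + p + 1 - s + j).choose (s - j) : ℚ) := by
    intro k
    induction k using Nat.strong_induction_on with
    | _ k ih =>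
      intro m hm hk
      have h := (hc m hm).trans (exist_half p s l hl m hm).symm
      rw [← sub_eq_zero, ← Finset.sum_sub_distrib, Finset.sum_eq_single m] at h
      · simp at h
        linarith
      · intro j hj hne
        have hj := Finset.mem_range.1 hj
        rcases lt_or_gt_of_ne hne with h1 | h1
        · simp [Nat.choose_eq_zero_of_lt h1]
        · rw [ih (s - j) (by omega) j (by omega) rfl, sub_self]
      · intro h1
        exact absurd (Finset.mem_range.2 (by omega)) h1
  exact fun j hj => main _ j hj rfl
end

section
/- Let p, n, i be natural numbers with 0 ≤ i ≤ min(p, n), and let φ : R_p ⊗ R_n → R_{p+n−2i} be a nonzero sl₂-equivariant linear map. Then φ(x^{p−j} y^{j} ⊗ x^{n}) ≠ 0 for every j with i ≤ j ≤ p. -/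
noncomputable section

/-- `R m`: the space of homogeneous polynomials of degree `m` in two variables `x, y`;
the coordinate at `k` is the coefficient of the monomial `x^(m-k) * y^k`. -/
abbrev R (m : ℕ) : Type := Fin (m + 1) → ℂ

/-- The monomial `x^(m-k) * y^k` in `R m`. -/
def mon (m : ℕ) (k : Fin (m + 1)) : R m := Pi.single k 1

/-- The operator `E = x·∂/∂y` on `R m`:
`E (x^(m-k) y^k) = k · x^(m-k+1) y^(k-1)`, i.e. `(E a) k = (k+1) * a (k+1)`. -/
def Eop (m : ℕ) : R m →ₗ[ℂ] R m where
  toFun a := fun k =>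
    if h : (k : ℕ) + 1 < m + 1 then ((k : ℕ) + 1 : ℂ) * a ⟨(k : ℕ) + 1, h⟩ else 0
  map_add' a b := by
    funext k
    by_cases h : (k : ℕ) + 1 < m + 1
    · simp only [dif_pos h, Pi.add_apply]; ring
    · simp only [dif_neg h, Pi.add_apply]; ring
  map_smul' c a := by
    funext k
    by_cases h : (k : ℕ) + 1 < m + 1
    · simp only [dif_pos h, Pi.smul_apply, smul_eq_mul, RingHom.id_apply]; ring
    · simp only [dif_neg h, Pi.smul_apply, smul_eq_mul, RingHom.id_apply]; ring

/-- The operator `F = y·∂/∂x` on `R m`: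
`F (x^(m-k) y^k) = (m-k) · x^(m-k-1) y^(k+1)`, i.e. `(F a) k = (m-k+1) * a (k-1)`. -/
def Fop (m : ℕ) : R m →ₗ[ℂ] R m where
  toFun a := fun k =>
    if _h : 0 < (k : ℕ) then
      ((m : ℂ) - (k : ℕ) + 1) * a ⟨(k : ℕ) - 1, by have := k.isLt; omega⟩
    else 0
  map_add' a b := by
    funext k
    by_cases h : 0 < (k : ℕ)
    · simp only [dif_pos h, Pi.add_apply]; ring
    · simp only [dif_neg h, Pi.add_apply]; ring
  map_smul' c a := by
    funext k
    by_cases h : 0 < (k : ℕ)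
    · simp only [dif_pos h, Pi.smul_apply, smul_eq_mul, RingHom.id_apply]; ring
    · simp only [dif_neg h, Pi.smul_apply, smul_eq_mul, RingHom.id_apply]; ring

/-- The operator `H = x·∂/∂x − y·∂/∂y` on `R m`: `(H a) k = (m - 2k) * a k`. -/
def Hop (m : ℕ) : R m →ₗ[ℂ] R m where
  toFun a := fun k => ((m : ℂ) - 2 * (k : ℕ)) * a k
  map_add' a b := by
    funext k; simp only [Pi.add_apply]; ring
  map_smul' c a := by
    funext k
    simp only [Pi.smul_apply, smul_eq_mul, RingHom.id_apply]; ring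

/-- A bilinear map `φ : R p × R n → R l` (equivalently, a linear map `R p ⊗ R n → R l`)
is `sl₂`-equivariant if it intertwines the actions of `E`, `F` and `H`, where `sl₂` acts
on the tensor product `R p ⊗ R n` by the Leibniz rule. -/
def Equivariant {p n l : ℕ} (φ : R p →ₗ[ℂ] R n →ₗ[ℂ] R l) : Prop :=
  (∀ u w, φ (Eop p u) w + φ u (Eop n w) = Eop l (φ u w)) ∧
  (∀ u w, φ (Fop p u) w + φ u (Fop n w) = Fop l (φ u w)) ∧
  (∀ u w, φ (Hop p u) w + φ u (Hop n w) = Hop l (φ u w))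

end

/-- The monomial indexed by a natural number, zero out of range. -/
def mo (m k : ℕ) : R m := fun q => if (q : ℕ) = k then 1 else 0

theorem mon_eq_mo (m : ℕ) (k : Fin (m + 1)) : mon m k = mo m k := by
  funext q
  simp [mon, mo, Pi.single_apply, Fin.ext_iff]

theorem Eop_mo_zero (m : ℕ) : Eop m (mo m 0) = 0 := by
  funext q
  simp [Eop, mo]

theorem Eop_mo_succ (m k : ℕ) (hk : k + 1 ≤ m) :
    Eop m (mo m (k + 1)) = ((k : ℂ) + 1) • mo m k := by
  funext q
  simp only [Eop, mo, LinearMap.coe_mk, AddHom.coe_mk, Pi.smul_apply, smul_eq_mul]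
  by_cases h : (q : ℕ) = k
  · rw [dif_pos (by omega)]; simp [h]
  · simp [h]

theorem Fop_mo (m k : ℕ) : Fop m (mo m k) = ((m : ℂ) - k) • mo m (k + 1) := by
  funext q
  simp only [Fop, mo, LinearMap.coe_mk, AddHom.coe_mk, Pi.smul_apply, smul_eq_mul]
  by_cases h : (q : ℕ) = k + 1
  · rw [dif_pos (by omega)]; simp [h]; ring
  · rw [if_neg h]
    split_ifs with h1 h2
    · omega
    · simp
    · simp

theorem Hop_mo (m k : ℕ) : Hop m (mo m k) = ((m : ℂ) - 2 * k) • mo m k := by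
  funext q
  simp only [Hop, mo, LinearMap.coe_mk, AddHom.coe_mk, Pi.smul_apply, smul_eq_mul]
  by_cases h : (q : ℕ) = k <;> simp [h]

theorem Eop_ker (m : ℕ) (v : R m) (hv : Eop m v = 0) (q : Fin (m + 1)) (hq : 0 < (q : ℕ)) :
    v q = 0 := by
  have h := congrFun hv ⟨(q : ℕ) - 1, by omega⟩
  have h1 : (q : ℕ) - 1 + 1 = q := by omega
  simp only [Eop, LinearMap.coe_mk, AddHom.coe_mk, Pi.zero_apply] at h
  rw [dif_pos (by omega)] at h
  simp only [h1, Fin.eta] at h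
  rcases mul_eq_zero.1 h with h | h
  · exfalso
    exact Nat.cast_add_one_ne_zero _ h
  · exact h

/-- Lemma 7.9 of the paper. Let `0 ≤ i ≤ min p n` and let
`φ : R_p ⊗ R_n → R_{p+n-2i}` be a nonzero `sl₂`-equivariant linear map.  Then
`φ(x^(p-j) y^j ⊗ x^n) ≠ 0` for every `i ≤ j ≤ p`. -/
theorem stmt11 (p n i : ℕ) (hip : i ≤ p) (hin : i ≤ n)
    (φ : R p →ₗ[ℂ] R n →ₗ[ℂ] R (p + n - 2 * i))
    (hequiv : Equivariant φ) (hφ : φ ≠ 0) :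
    ∀ j : ℕ, (hij : i ≤ j) → (hjp : j ≤ p) →
      φ (mon p ⟨j, by omega⟩) (mon n ⟨0, by omega⟩) ≠ 0 := by
  obtain ⟨hE, hF, hH⟩ := hequiv
  intro j hij hjp h0
  rw [mon_eq_mo, mon_eq_mo] at h0
  simp only at h0
  apply hφ
  have supp : ∀ a b (q : Fin (p + n - 2 * i + 1)), (q : ℕ) + i ≠ a + b →
      φ (mo p a) (mo n b) q = 0 := by
    intro a b q hq
    have h := congrFun (hH (mo p a) (mo n b)) q
    rw [Hop_mo, Hop_mo] at h
    simp only [map_smul, LinearMap.smul_apply, Pi.add_apply, Pi.smul_apply, smul_eq_mul, Hop,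
      LinearMap.coe_mk, AddHom.coe_mk] at h
    rw [Nat.cast_sub (by omega)] at h
    push_cast at h
    have h2 : (((q : ℕ) + i : ℂ) - (a + b)) * φ (mo p a) (mo n b) q = 0 := by
      linear_combination h / 2
    rcases mul_eq_zero.1 h2 with h3 | h3
    · exfalso
      apply hq
      have := sub_eq_zero.1 h3
      exact_mod_cast this
    · exact h3
  have low : ∀ a b, a + b < i → φ (mo p a) (mo n b) = 0 := by
    intro a b h
    funext q
    exact supp a b q (by omega)
  -- descend to `j = i`
  have desc : ∀ d, i + d ≤ p → φ (mo p (i + d)) (mo n 0) = 0 → φ (mo p i) (mo n 0) = 0 := by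
    intro d
    induction d with
    | zero => intro _ h; exact h
    | succ d ih =>
      intro hd h
      apply ih (by omega)
      have h1 := hE (mo p (i + d + 1)) (mo n 0)
      rw [Eop_mo_zero, Eop_mo_succ _ _ (by omega), ← add_assoc] at *
      rw [h] at h1
      simp only [map_smul, LinearMap.smul_apply, map_zero, add_zero] at h1
      rcases smul_eq_zero.1 h1 with h2 | h2
      · exact absurd h2 (Nat.cast_add_one_ne_zero _)
      · exact h2
  have hi : φ (mo p i) (mo n 0) = 0 := by
    obtain ⟨d, rfl⟩ := Nat.exists_eq_add_of_le hij
    exact desc d hjp h0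
  have diag : ∀ b a, a + b = i → φ (mo p a) (mo n b) = 0 := by
    intro b
    induction b with
    | zero => intro a ha; obtain rfl : a = i := by omega
              exact hi
    | succ b ih =>
      intro a ha
      have h1 := hF (mo p a) (mo n b)
      rw [Fop_mo, Fop_mo, low a b (by omega)] at h1
      simp only [map_smul, LinearMap.smul_apply, map_zero] at h1
      rw [ih (a + 1) (by omega), smul_zero, zero_add] at h1
      rcases smul_eq_zero.1 h1 with h2 | h2
      · exfalso
        have : n = b := by exact_mod_cast sub_eq_zero.1 h2
        omega
      · exact h2
  have all : ∀ t a b, a + b = t → a ≤ p → b ≤ n → φ (mo p a) (mo n b) = 0 := by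
    intro t
    induction t with
    | zero =>
      intro a b h _ _
      rcases Nat.eq_zero_or_pos i with h' | h'
      · exact diag b a (by omega)
      · exact low a b (by omega)
    | succ t ih =>
      intro a b h ha hb
      rcases lt_trichotomy (a + b) i with h' | h' | h'
      · exact low a b h'
      · exact diag b a h'
      · have h1 : φ (Eop p (mo p a)) (mo n b) = 0 := by
          rcases a with _ | a
          · simp [Eop_mo_zero]
          · rw [Eop_mo_succ _ _ ha]
            simp [ih a b (by omega) (by omega) hb]
        have h2 : φ (mo p a) (Eop n (mo n b)) = 0 := by
          rcases b with _ | b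
          · simp [Eop_mo_zero]
          · rw [Eop_mo_succ _ _ hb]
            simp [ih a b (by omega) ha (by omega)]
        have h3 := hE (mo p a) (mo n b)
        rw [h1, h2, add_zero] at h3
        funext q
        by_cases hq : (q : ℕ) + i = a + b
        · exact Eop_ker _ _ h3.symm q (by omega)
        · exact supp a b q hq
  refine (Pi.basisFun ℂ (Fin (p + 1))).ext fun a => (Pi.basisFun ℂ (Fin (n + 1))).ext fun b => ?_
  have h := all _ a b rfl (by omega) (by omega)
  rw [← mon_eq_mo, ← mon_eq_mo] at h
  simpa [mon] using h
end

section
/- Let p, n, i be natural numbers with 0 ≤ i ≤ min(p, n), and let φ : R_p ⊗ R_n → R_{p+n−2i} be a nonzero sl₂-equivariant linear map. Then φ(x^{j} y^{p−j} ⊗ y^{n}) ≠ 0 for every j with i ≤ j ≤ p. -/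
lemma aux_E (m k : ℕ) (h : k + 1 < m + 1) :
    Eop m (mon m ⟨k + 1, h⟩) = ((k : ℂ) + 1) • mon m ⟨k, by omega⟩ := by
  funext t
  simp only [Eop, mon, LinearMap.coe_mk, AddHom.coe_mk, Pi.smul_apply, smul_eq_mul,
    Pi.single_apply, Fin.ext_iff]
  by_cases h1 : (t : ℕ) = k
  · simp [h1]; intro; omega
  · simp [h1]

lemma aux_F (m k : ℕ) (h : k + 1 < m + 1) :
    Fop m (mon m ⟨k, by omega⟩) = ((m : ℂ) - k) • mon m ⟨k + 1, h⟩ := by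
  funext t
  simp only [Fop, mon, LinearMap.coe_mk, AddHom.coe_mk, Pi.smul_apply, smul_eq_mul,
    Pi.single_apply, Fin.ext_iff]
  by_cases h1 : (t : ℕ) = k + 1
  · simp [h1]; ring
  · have : 0 < (t : ℕ) → ¬ ((t : ℕ) - 1 = k) := by omega
    by_cases h2 : 0 < (t : ℕ)
    · simp [h1, this h2]
    · simp [h1, h2]

lemma aux_Flast (m : ℕ) : Fop m (mon m (Fin.last m)) = 0 := by
  funext t
  have := t.isLt
  have h3 : 0 < (t : ℕ) → ¬ ((t : ℕ) - 1 = m) := by omega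
  simp only [Fop, mon, LinearMap.coe_mk, AddHom.coe_mk, Pi.zero_apply,
    Pi.single_apply, Fin.ext_iff, Fin.val_last]
  by_cases h2 : 0 < (t : ℕ)
  · simp [h3 h2]
  · simp [h2]

lemma aux_H (m : ℕ) (k : Fin (m + 1)) :
    Hop m (mon m k) = ((m : ℂ) - 2 * (k : ℕ)) • mon m k := by
  funext t
  simp only [Hop, mon, LinearMap.coe_mk, AddHom.coe_mk, Pi.smul_apply, smul_eq_mul,
    Pi.single_apply]
  by_cases h1 : t = k <;> simp [h1]

lemma aux_ext {m : ℕ} {V : Type*} [AddCommGroup V] [Module ℂ V] (f : R m →ₗ[ℂ] V)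
    (h : ∀ k, f (mon m k) = 0) : f = 0 := by
  apply LinearMap.pi_ext'
  intro k
  ext
  simpa [mon] using h k

/-- Remark after Lemma 7.9 of the paper. Let `0 ≤ i ≤ min p n` and let
`φ : R_p ⊗ R_n → R_{p+n-2i}` be a nonzero `sl₂`-equivariant linear map.  Then
`φ(x^j y^(p-j) ⊗ y^n) ≠ 0` for every `i ≤ j ≤ p`. -/
theorem stmt12 (p n i : ℕ) (hip : i ≤ p) (hin : i ≤ n)
    (φ : R p →ₗ[ℂ] R n →ₗ[ℂ] R (p + n - 2 * i))
    (hequiv : Equivariant φ) (hφ : φ ≠ 0) :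
    ∀ j : ℕ, (hij : i ≤ j) → (hjp : j ≤ p) →
      φ (mon p ⟨p - j, by omega⟩) (mon n (Fin.last n)) ≠ 0 := by
  intro j hij hjp h0
  obtain ⟨hE, hF, hH⟩ := hequiv
  apply hφ
  -- F-step
  have hstep : ∀ a (ha : a + 1 < p + 1),
      ((p : ℂ) - a) • φ (mon p ⟨a + 1, ha⟩) (mon n (Fin.last n)) =
      Fop _ (φ (mon p ⟨a, by omega⟩) (mon n (Fin.last n))) := by
    intro a ha
    rw [← hF, aux_Flast, aux_F p a ha]
    simp
  have hup : ∀ a (ha : a < p + 1), p - j ≤ a →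
      φ (mon p ⟨a, ha⟩) (mon n (Fin.last n)) = 0 := by
    intro a ha hle
    induction a, hle using Nat.le_induction with
    | base => exact h0
    | succ a hle ih =>
      have h := hstep a ha
      rw [ih (by omega), map_zero, smul_eq_zero] at h
      rcases h with h | h
      · exfalso
        have : (p : ℂ) = a := sub_eq_zero.mp h
        have : p = a := by exact_mod_cast this
        omega
      · exact h
  have hdown : ∀ d a (ha : a < p + 1), a + d = p - j →
      φ (mon p ⟨a, ha⟩) (mon n (Fin.last n)) = 0 := by
    intro d
    induction d with
    | zero => intro a ha hd; exact hup a ha (by omega)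
    | succ d ih =>
      intro a ha hd
      have h := hstep a (by omega)
      rw [ih (a + 1) (by omega) (by omega), smul_zero] at h
      have hw := hH (mon p ⟨a, ha⟩) (mon n (Fin.last n))
      rw [aux_H, aux_H] at hw
      set v := φ (mon p ⟨a, ha⟩) (mon n (Fin.last n)) with hv
      funext k
      have hk := k.isLt
      by_cases hkl : (k : ℕ) = p + n - 2 * i
      · have hw' := congrFun hw k
        simp only [map_smul, LinearMap.smul_apply, ← hv, Hop, LinearMap.coe_mk, AddHom.coe_mk,
          Pi.add_apply, Pi.smul_apply, smul_eq_mul, Fin.val_last] at hw'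
        rw [hkl, Nat.cast_sub (by omega)] at hw'
        push_cast at hw'
        have h2 : ((p : ℂ) - i - a) * v k = 0 := by linear_combination hw' / 2
        rcases mul_eq_zero.mp h2 with h3 | h3
        · exfalso
          have : (p : ℂ) = (a + i : ℕ) := by push_cast; linear_combination h3
          have : p = a + i := by exact_mod_cast this
          omega
        · exact h3
      · have h' := congrFun h ⟨k + 1, by omega⟩
        simp only [Fop, LinearMap.coe_mk, AddHom.coe_mk, Pi.zero_apply] at h'
        rw [dif_pos (by omega)] at h'
        rcases mul_eq_zero.mp h'.symm with h3 | h3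
        · exfalso
          have : ((p + n - 2 * i : ℕ) : ℂ) = (k : ℕ) := by
            push_cast at h3 ⊢
            linear_combination h3
          exact hkl (by exact_mod_cast this.symm)
        · exact h3
  have hlast : ∀ u, φ u (mon n (Fin.last n)) = 0 := by
    have : φ.flip (mon n (Fin.last n)) = 0 := by
      apply aux_ext
      rintro ⟨a, ha⟩
      rw [LinearMap.flip_apply]
      by_cases h : p - j ≤ a
      · exact hup a ha h
      · exact hdown (p - j - a) a ha (by omega)
    intro u
    rw [← LinearMap.flip_apply, this]; rfl
  have hall : ∀ d b (hb : b < n + 1), b + d = n → ∀ u, φ u (mon n ⟨b, hb⟩) = 0 := by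
    intro d
    induction d with
    | zero =>
      intro b hb hd u
      obtain rfl : b = n := by omega
      exact hlast u
    | succ d ih =>
      intro b hb hd u
      have h := hE u (mon n ⟨b + 1, by omega⟩)
      rw [ih _ _ (by omega), ih _ _ (by omega), map_zero, zero_add, aux_E, map_smul,
        smul_eq_zero] at h
      rcases h with h | h
      · exact absurd h (by exact_mod_cast Nat.succ_ne_zero b)
      · exact h
  apply aux_ext
  intro u
  apply aux_ext
  rintro ⟨b, hb⟩
  exact hall (n - b) b hb (by omega) _
end

section
/- Let p, l, i be natural numbers with 0 ≤ i ≤ min(l, p), set m = l + p − 2i, and let φ : R_p ⊗ R_m → R_l be a nonzero sl₂-equivariant linear map. Suppose w ∈ R_m has height n, where n ≤ l − i. Then φ(y^p ⊗ w) has height n + i. -/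
/-- A nonzero vector `w = Σ_k a_k x^(m-k) y^k` in `R m` has height `n` if `a_n ≠ 0` and
`a_k = 0` for all `k > n`. -/
def HasHeight {m : ℕ} (w : R m) (n : ℕ) : Prop :=
  ∃ hn : n < m + 1, w ⟨n, hn⟩ ≠ 0 ∧ ∀ k : Fin (m + 1), n < (k : ℕ) → w k = 0

/-- The monomial of `y`-degree `k`, with a natural-number index (zero if `k > m`). -/
def mn (m k : ℕ) : R m := fun j => if (j : ℕ) = k then 1 else 0

theorem mn_last (m : ℕ) : mon m (Fin.last m) = mn m m := by
  funext j
  simp [mon, mn, Pi.single_apply, Fin.ext_iff]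

theorem expand_mn {m : ℕ} (w : R m) : w = ∑ b : Fin (m + 1), w b • mn m b := by
  funext j
  simp [mn, Finset.sum_apply, ← Fin.ext_iff]

theorem Eop_mn (m k : ℕ) (hk : k + 1 ≤ m) : Eop m (mn m (k + 1)) = ((k : ℂ) + 1) • mn m k := by
  funext j
  by_cases h : (j : ℕ) = k
  · simp [Eop, mn, h]; omega
  · simp [Eop, mn, h]

theorem Fop_mn (m k : ℕ) : Fop m (mn m k) = ((m : ℂ) - k) • mn m (k + 1) := by
  funext j
  by_cases h : (j : ℕ) = k + 1
  · have h0 : 0 < (j : ℕ) := by omega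
    simp only [Fop, mn, h, LinearMap.coe_mk, AddHom.coe_mk, Pi.smul_apply]
    simp
    ring
  · have h2 : 0 < (j : ℕ) → ¬ ((j : ℕ) - 1 = k) := by omega
    simp only [Fop, mn, h, LinearMap.coe_mk, AddHom.coe_mk, Pi.smul_apply, if_false, smul_zero]
    split_ifs with h3 h4
    · exact absurd h4 (h2 h3)
    · simp
    · rfl

theorem Hop_mn (m k : ℕ) : Hop m (mn m k) = ((m : ℂ) - 2 * k) • mn m k := by
  funext j
  by_cases h : (j : ℕ) = k
  · simp [Hop, mn, h]
  · simp [Hop, mn, h]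

theorem aux_height (p l i M : ℕ) (hM : M = l + p - 2 * i) (hil : i ≤ l) (hip : i ≤ p)
    (φ : R p →ₗ[ℂ] R M →ₗ[ℂ] R l)
    (hequiv : Equivariant φ) (hφ : φ ≠ 0)
    (w : R M) (n : ℕ) (hn : n ≤ l - i) (hw : HasHeight w n) :
    HasHeight (φ (mon p (Fin.last p)) w) (n + i) := by
  obtain ⟨hE, hF, hH⟩ := hequiv
  have hMC : (M : ℂ) = l + p - 2 * i := by
    have : M + 2 * i = l + p := by omega
    have h2 : (M : ℂ) + 2 * i = l + p := by exact_mod_cast this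
    linear_combination h2
  have hv : ∀ b : ℕ, ∃ c : ℂ, φ (mn p p) (mn M b) = c • mn l (b + i) := by
    intro b
    have key : ∀ k : Fin (l + 1), (k : ℕ) ≠ b + i → φ (mn p p) (mn M b) k = 0 := by
      intro k hk
      have h := congrFun (hH (mn p p) (mn M b)) k
      rw [Hop_mn, Hop_mn] at h
      simp only [map_smul, LinearMap.smul_apply, Pi.add_apply, Pi.smul_apply, smul_eq_mul, Hop,
        LinearMap.coe_mk, AddHom.coe_mk] at h
      have h3 : ((k : ℕ) - ((b + i : ℕ) : ℂ)) * φ (mn p p) (mn M b) k = 0 := by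
        rw [hMC] at h
        push_cast
        linear_combination h / 2
      rcases mul_eq_zero.1 h3 with h4 | h4
      · exact absurd (by exact_mod_cast sub_eq_zero.1 h4) hk
      · exact h4
    by_cases hb : b + i < l + 1
    · refine ⟨φ (mn p p) (mn M b) ⟨b + i, hb⟩, ?_⟩
      funext k
      by_cases hk : (k : ℕ) = b + i
      · have : k = ⟨b + i, hb⟩ := Fin.ext hk
        subst this
        simp [mn]
      · rw [key k hk]; simp [mn, hk]
    · refine ⟨0, ?_⟩
      funext k
      rw [key k (by have := k.isLt; omega)]; simp
  choose c hc using hv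
  have hrec : ∀ b : ℕ, b + 1 + i ≤ l → ((M : ℂ) - b) * c (b + 1) = (l - (b + i : ℕ)) * c b := by
    intro b hb
    have h := congrFun (hF (mn p p) (mn M b)) ⟨b + 1 + i, by omega⟩
    rw [Fop_mn, Fop_mn, hc, map_smul, map_smul, hc, map_smul, Fop_mn] at h
    have e : b + 1 + i = b + i + 1 := by omega
    simp [mn, e] at h
    push_cast
    linear_combination h
  have hc0 : c 0 ≠ 0 := by
    intro h0
    apply hφ
    have hz : ∀ b : ℕ, b + i ≤ l → c b = 0 := by
      intro b
      induction b with
      | zero => intro _; exact h0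
      | succ b ih =>
        intro hb
        have h := hrec b hb
        rw [ih (by omega), mul_zero] at h
        rcases mul_eq_zero.1 h with h4 | h4
        · have : M = b := by exact_mod_cast sub_eq_zero.1 h4
          omega
        · exact h4
    have hp : φ (mn p p) = 0 := by
      apply LinearMap.ext
      intro w
      have : ∀ b : ℕ, φ (mn p p) (mn M b) = 0 := by
        intro b
        rw [hc]
        by_cases hb : b + i ≤ l
        · rw [hz b hb, zero_smul]
        · funext k
          have := k.isLt
          have h5 : (k : ℕ) ≠ b + i := by omega
          simp [mn, h5]
      rw [expand_mn w, map_sum]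
      simp [this]
    have ha : ∀ d : ℕ, d ≤ p → φ (mn p (p - d)) = 0 := by
      intro d
      induction d with
      | zero => intro _; exact hp
      | succ d ih =>
        intro hd
        have ih' := ih (by omega)
        apply LinearMap.ext
        intro w
        have h := hE (mn p (p - d)) w
        have e : p - d = (p - (d + 1)) + 1 := by omega
        rw [ih'] at h
        rw [e, Eop_mn _ _ (by omega)] at h
        simp only [map_smul, LinearMap.smul_apply, LinearMap.zero_apply, map_zero, add_zero] at h
        rcases smul_eq_zero.1 h with h4 | h4
        · exact absurd h4 (Nat.cast_add_one_ne_zero _)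
        · simpa using h4
    apply LinearMap.ext
    intro u
    rw [expand_mn u, map_sum, LinearMap.zero_apply]
    apply Finset.sum_eq_zero
    intro a _
    have h := ha (p - a) (by omega)
    have e : p - (p - (a : ℕ)) = a := by have := a.isLt; omega
    rw [e] at h
    rw [map_smul, h, smul_zero]
  have hcn : ∀ b : ℕ, b + i ≤ l → c b ≠ 0 := by
    intro b
    induction b with
    | zero => intro _; exact hc0
    | succ b ih =>
      intro hb h0
      have h := hrec b hb
      rw [h0, mul_zero] at h
      rcases mul_eq_zero.1 h.symm with h4 | h4
      · have : l = b + i := by exact_mod_cast sub_eq_zero.1 h4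
        omega
      · exact ih (by omega) h4
  obtain ⟨hnM, hwn, hw0⟩ := hw
  have hval : ∀ k : Fin (l + 1), φ (mn p p) w k
      = ∑ b : Fin (M + 1), w b * (c b * mn l (b + i) k) := by
    intro k
    conv_lhs => rw [expand_mn w, map_sum]
    simp [hc]
  rw [mn_last]
  refine ⟨by omega, ?_, ?_⟩
  · rw [hval, Finset.sum_eq_single ⟨n, hnM⟩]
    · simp only [mn, if_true, mul_one]
      exact mul_ne_zero hwn (hcn n (by omega))
    · intro b _ hb
      have : ¬ (n + i = (b : ℕ) + i) := fun h => hb (Fin.ext (by simp; omega))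
      simp only [mn, this, if_false, mul_zero]
    · simp
  · intro k hk
    rw [hval]
    apply Finset.sum_eq_zero
    intro b _
    by_cases hb : n < (b : ℕ)
    · rw [hw0 b hb, zero_mul]
    · have : ¬ ((k : ℕ) = (b : ℕ) + i) := by omega
      simp only [mn, this, if_false, mul_zero]


/-- part (2) of the lemma before Theorem 7.20. Let `0 ≤ i ≤ min l p`,
`m = l + p - 2i`, and let `φ : R_p ⊗ R_m → R_l` be a nonzero `sl₂`-equivariant linear map.
If `w ∈ R_m` has height `n ≤ l - i`, then `φ(y^p ⊗ w)` has height `n + i`. -/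
theorem stmt15 (p l i : ℕ) (hil : i ≤ l) (hip : i ≤ p)
    (φ : R p →ₗ[ℂ] R (l + p - 2 * i) →ₗ[ℂ] R l)
    (hequiv : Equivariant φ) (hφ : φ ≠ 0)
    (w : R (l + p - 2 * i)) (n : ℕ) (hn : n ≤ l - i) (hw : HasHeight w n) :
    HasHeight (φ (mon p (Fin.last p)) w) (n + i) := by
  exact aux_height p l i _ rfl hil hip φ hequiv hφ w n hn hw
end

section
/- Let V be a complex vector space equipped with an sl₂(ℂ)-module structure given by linear endomorphisms e, f, h of V satisfying h∘e − e∘h = 2e, h∘f − f∘h = −2f, e∘f − f∘e = h. Let p ≥ 1 and let σ : R_p ⊗ V → V be an sl₂-equivariant linear map, where sl₂(ℂ) acts on R_p ⊗ V by X·(u ⊗ w) = (X·u) ⊗ w + u ⊗ (X·w), with X acting on V as e, f, h respectively. Suppose v ∈ V satisfies σ(y^p ⊗ v) = e(v) and σ(x^{i} y^{p−i} ⊗ v) = 0 for all 1 ≤ i ≤ p. Define μ : V → V by μ(w) = σ(y^p ⊗ w). Then: (1) μ^j(v) = e^j(v) for every j ≥ 1; and (2) σ(x^{i} y^{p−i}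 ⊗ e^j(v)) = 0 for all 1 ≤ i ≤ p and all j ≥ 0. -/
theorem Eop_mon_zero (m : ℕ) (hk : 0 < m + 1) : Eop m (mon m ⟨0, hk⟩) = 0 := by
  funext i
  simp [Eop, mon, Pi.single_apply]

theorem Eop_mon_succ (m k : ℕ) (hk : k + 1 < m + 1) :
    Eop m (mon m ⟨k + 1, hk⟩) = ((k : ℂ) + 1) • mon m ⟨k, by omega⟩ := by
  funext i
  by_cases hi : (i : ℕ) = k
  · have : i = ⟨k, by omega⟩ := Fin.ext hi
    rw [this]
    simp [Eop, mon, Pi.single_apply]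
    omega
  · have h2 : i ≠ ⟨k, by omega⟩ := fun h => hi (by rw [h])
    simp [Eop, mon, Pi.single_apply, hi, h2]

/-- Corollary after Lemma 7.12 of the paper. Let `V` be an `sl₂`-module
with operators `e, f, h`, let `p ≥ 1` and let `σ : R_p ⊗ V → V` be `sl₂`-equivariant.
Suppose `v ∈ V` satisfies `σ(y^p ⊗ v) = e v` and `σ(x^i y^(p-i) ⊗ v) = 0` for `1 ≤ i ≤ p`.
Then, with `μ(w) = σ(y^p ⊗ w)`: (1) `μ^j v = e^j v` for all `j ≥ 1`, and
(2) `σ(x^i y^(p-i) ⊗ e^j v) = 0` for all `1 ≤ i ≤ p` and all `j ≥ 0`. -/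
theorem stmt16 {V : Type*} [AddCommGroup V] [Module ℂ V]
    (e f h : V →ₗ[ℂ] V)
    (rel1 : h ∘ₗ e - e ∘ₗ h = 2 • e)
    (rel2 : h ∘ₗ f - f ∘ₗ h = -(2 • f))
    (rel3 : e ∘ₗ f - f ∘ₗ e = h)
    (p : ℕ) (hp : 1 ≤ p)
    (σ : R p →ₗ[ℂ] V →ₗ[ℂ] V)
    (equivE : ∀ u w, σ (Eop p u) w + σ u (e w) = e (σ u w))
    (equivF : ∀ u w, σ (Fop p u) w + σ u (f w) = f (σ u w))
    (equivH : ∀ u w, σ (Hop p u) w + σ u (h w) = h (σ u w))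
    (v : V)
    (hyp : σ (mon p (Fin.last p)) v = e v)
    (hzero : ∀ i : ℕ, 1 ≤ i → i ≤ p → σ (mon p ⟨p - i, by omega⟩) v = 0) :
    (∀ j : ℕ, 1 ≤ j →
      (fun w => σ (mon p (Fin.last p)) w)^[j] v = (⇑e)^[j] v) ∧
    (∀ i : ℕ, 1 ≤ i → i ≤ p → ∀ j : ℕ,
      σ (mon p ⟨p - i, by omega⟩) ((⇑e)^[j] v) = 0) := by
  have key : ∀ j : ℕ, (∀ k : ℕ, ∀ hk : k < p,
      σ (mon p ⟨k, by omega⟩) ((⇑e)^[j] v) = 0) ∧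
      σ (mon p (Fin.last p)) ((⇑e)^[j] v) = (⇑e)^[j + 1] v := by
    intro j
    induction j with
    | zero =>
      refine ⟨fun k hk => ?_, by simpa using hyp⟩
      have h1 := hzero (p - k) (by omega) (by omega)
      have h2 : (⟨p - (p - k), by omega⟩ : Fin (p + 1)) = ⟨k, by omega⟩ :=
        Fin.ext (by simp only; omega)
      rw [h2] at h1
      simpa using h1
    | succ j ih =>
      obtain ⟨ih1, ih2⟩ := ih
      have hE : ∀ k : ℕ, ∀ hk : k < p + 1,
          σ (Eop p (mon p ⟨k, hk⟩)) ((⇑e)^[j] v) = 0 := by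
        intro k hk
        cases k with
        | zero => rw [Eop_mon_zero]; simp
        | succ k =>
          rw [Eop_mon_succ, map_smul, LinearMap.smul_apply, ih1 k (by omega), smul_zero]
      refine ⟨fun k hk => ?_, ?_⟩
      · have h1 := equivE (mon p ⟨k, by omega⟩) ((⇑e)^[j] v)
        rw [hE, zero_add, ih1 k hk, map_zero] at h1
        rw [Function.iterate_succ_apply']
        exact h1
      · have h1 := equivE (mon p (Fin.last p)) ((⇑e)^[j] v)
        have h2 : σ (Eop p (mon p (Fin.last p))) ((⇑e)^[j] v) = 0 := hE p (by omega)
        rw [h2, zero_add, ih2] at h1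
        rw [Function.iterate_succ_apply' _ (j + 1), ← h1, Function.iterate_succ_apply']
  refine ⟨fun j _ => ?_, fun i hi hip j => (key j).1 (p - i) (by omega)⟩
  clear * - key
  induction j with
  | zero => rfl
  | succ j ih =>
    rw [Function.iterate_succ_apply', ih]
    exact (key j).2
end
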